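/- Fix real constants A, B with A > 0 and A·B > 1. For (x, z) ∈ ℝ² let G(x, z) = [[A·e^z, 1, 0], [1, x² + B·e^{−z}, x], [0, x, 1]], and define the vectors v₁ = (0, 0, 1), v₂(z) = (1/√(A·e^z), 0, 0), and v₃(x, z) = √(A·e^z/(A·B − 1)) · (−1/(A·e^z), 1, −x). Then for every (x, z) ∈ ℝ² the triple (v₁, v₂(z), v₃(x, z)) is orthonormal with respect to the bilinear form determined by G(x, z): vᵢᵀ · G(x, z) · vⱼ = 1 if i = j and 0 if i ≠ j. Moreover β(p)(v₂(z)) = 0 and β(p)(v₃(x, z)) = 0 at every point p with first coordinate x, where β(p)(v) = v₃ + p₁·v₂; that is, v₂ and v₃ form an orthonormal frame of the contact plane ker β. -/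

import Mathlib

open Real Matrix

/-- Krouglov's candidate compatible metric on `ℝ³`:
`G(x, z) = [[A·e^z, 1, 0], [1, x² + B·e^{-z}, x], [0, x, 1]]`. -/
noncomputable def krouglovMetric (A B x z : ℝ) : Matrix (Fin 3) (Fin 3) ℝ :=
  !![A * exp z, 1, 0;
     1, x ^ 2 + B * exp (-z), x;
     0, x, 1]

/-- The contact form `β = dz + x·dy`: at `p`, `β p v = v₃ + p₁·v₂`. -/
noncomputable def contactFormβ (p v : Fin 3 → ℝ) : ℝ := v 2 + p 0 * v 1

/-- The Reeb direction `v₁ = ∂z`. -/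
noncomputable def frameV₁ : Fin 3 → ℝ := ![0, 0, 1]

/-- The frame vector `v₂(z) = (1/√(A·e^z)) ∂x`. -/
noncomputable def frameV₂ (A z : ℝ) : Fin 3 → ℝ := ![1 / Real.sqrt (A * exp z), 0, 0]

/-- The frame vector `v₃(x, z) = √(A·e^z/(A·B - 1)) · (-(1/(A·e^z)) ∂x + ∂y - x ∂z)`. -/
noncomputable def frameV₃ (A B x z : ℝ) : Fin 3 → ℝ :=
  Real.sqrt (A * exp z / (A * B - 1)) • ![-(1 / (A * exp z)), 1, -x]

/-- For `A > 0`, `A·B > 1`, the triple `(v₁, v₂(z), v₃(x, z))` is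
orthonormal for the bilinear form given by `G(x, z)`, and `v₂, v₃` lie in the kernel of
the contact form `β = dz + x·dy`; i.e. `(v₂, v₃)` is an orthonormal frame of the contact
planes. -/
theorem krouglov_frame_orthonormal (A B : ℝ) (hA : 0 < A) (hAB : 1 < A * B) :
    ∀ x z : ℝ,
      (∀ i j : Fin 3,
        (![frameV₁, frameV₂ A z, frameV₃ A B x z] i) ⬝ᵥ
            (krouglovMetric A B x z *ᵥ ![frameV₁, frameV₂ A z, frameV₃ A B x z] j)
          = if i = j then 1 else 0) ∧
      (∀ p : Fin 3 → ℝ, p 0 = x →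
        contactFormβ p (frameV₂ A z) = 0 ∧ contactFormβ p (frameV₃ A B x z) = 0) := by
  intro x z
  have ha : 0 < A * exp z := by positivity
  have hc : 0 < A * B - 1 := by linarith
  have hs : √(A * exp z) ≠ 0 := (sqrt_pos.mpr ha).ne'
  have hs2 : √(A * exp z) ^ 2 = A * exp z := sq_sqrt ha.le
  have ht2 : √(A * exp z / (A * B - 1)) ^ 2 = A * exp z / (A * B - 1) :=
    sq_sqrt (div_pos ha hc).le
  have hB : B * exp (-z) = A * B / (A * exp z) := by
    rw [exp_neg]
    field_simp
  simp only [krouglovMetric, contactFormβ, frameV₁, frameV₂, frameV₃, hB]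
  generalize √(A * exp z / (A * B - 1)) = t at *
  generalize √(A * exp z) = s at *
  generalize A * exp z = a at *
  refine ⟨fun i j => ?_, fun p hp => ?_⟩
  · fin_cases i <;> fin_cases j <;>
      simp [dotProduct, mulVec, Fin.sum_univ_three] <;> grind
  · subst hp
    constructor
    · simp
    · simp
      ring
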